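/- Let R₁, R₂ be both ternary or both quaternary relations first-order definable in a liberal finitely bounded homogeneous binary core 𝔸, let R₃ := R₁ ⋈ R₂, and let O₁, O₂, O₃ be orbitals. Then: (i) if R₁ contains an O₁O₂-tuple t₁ and R₂ contains an O₂⁻¹O₃-tuple t₂, then R₃ contains an O₁O₃-tuple; (ii) if moreover t₁ and t₂ are injective, then R₃ contains all injective O₁O₃-tuples; and (iii) if O₁, O₂, O₃ all equal the equality relation and both t₁ and t₂ are non-constant, then R₃ contains all non-constant ==-tuples. -/

import Mathlib

set_option autoImplicit false

namespace Wrona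

/-- A general relational structure over domain `A`. -/
structure RelStruct (A : Type) : Type 1 where
  ι : Type
  arity : ι → ℕ
  rel : (i : ι) → (Fin (arity i) → A) → Prop

variable {A : Type}

/-- Primitive-positive formulas over a relational structure
    (conjunction, existential quantification and atoms, including equality). -/
inductive PP (S : RelStruct A) : Type where
  | atom (i : S.ι) (v : Fin (S.arity i) → ℕ) : PP S
  | eq (x y : ℕ) : PP S
  | conj (φ ψ : PP S) : PP S
  | ex (x : ℕ) (φ : PP S) : PP S

def PP.sat {S : RelStruct A} : PP S → (ℕ → A) → Prop
  | .atom i v, f => S.rel i fun k => f (v k)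
  | .eq x y, f => f x = f y
  | .conj φ ψ, f => φ.sat f ∧ ψ.sat f
  | .ex x φ, f => ∃ a : A, φ.sat (Function.update f x a)

/-- First-order formulas over a relational structure. -/
inductive FO (S : RelStruct A) : Type where
  | atom (i : S.ι) (v : Fin (S.arity i) → ℕ) : FO S
  | eq (x y : ℕ) : FO S
  | neg (φ : FO S) : FO S
  | conj (φ ψ : FO S) : FO S
  | ex (x : ℕ) (φ : FO S) : FO S

def FO.sat {S : RelStruct A} : FO S → (ℕ → A) → Prop
  | .atom i v, f => S.rel i fun k => f (v k)
  | .eq x y, f => f x = f y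
  | .neg φ, f => ¬ φ.sat f
  | .conj φ ψ, f => φ.sat f ∧ ψ.sat f
  | .ex x φ, f => ∃ a : A, φ.sat (Function.update f x a)

/-- An `n`-ary relation is pp-definable in `S` (variables `0,…,n-1` are the free variables). -/
def PPDef (S : RelStruct A) (n : ℕ) (R : (Fin n → A) → Prop) : Prop :=
  ∃ φ : PP S, ∀ f : ℕ → A, φ.sat f ↔ R fun i => f i.val

/-- An `n`-ary relation is first-order definable in `S`. -/
def FODef (S : RelStruct A) (n : ℕ) (R : (Fin n → A) → Prop) : Prop :=
  ∃ φ : FO S, ∀ f : ℕ → A, φ.sat f ↔ R fun i => f i.val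

/-- A binary relation is pp-definable in `S`. -/
def PPDef2 (S : RelStruct A) (C : A → A → Prop) : Prop :=
  PPDef S 2 fun t => C (t 0) (t 1)

/-- The equality relation. -/
def eqRel (A : Type) : A → A → Prop := fun a b => a = b

/-- A binary core: a structure with (equality and) binary anti-reflexive relations
`R₁,…,R_κ` such that any two distinct elements are related by exactly one `R_i`. -/
structure BinaryCore (A : Type) (κ : ℕ) : Type where
  rel : Fin κ → A → A → Prop
  antirefl : ∀ i a b, rel i a b → a ≠ b
  total : ∀ a b : A, a ≠ b → ∃ i, rel i a b
  unique : ∀ i j a b, rel i a b → rel j a b → i = j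

variable {κ : ℕ}

/-- The binary core viewed as a relational structure. -/
def BinaryCore.toRel (𝔸 : BinaryCore A κ) : RelStruct A :=
  ⟨Fin κ, fun _ => 2, fun i u => 𝔸.rel i (u 0) (u 1)⟩

/-- Automorphisms of a binary core. -/
def IsAuto (𝔸 : BinaryCore A κ) (g : A ≃ A) : Prop :=
  ∀ i a b, 𝔸.rel i (g a) (g b) ↔ 𝔸.rel i a b

/-- Homogeneity: every isomorphism between finite induced substructures extends
    to an automorphism. -/
def IsHomogeneous (𝔸 : BinaryCore A κ) : Prop :=
  ∀ S : Set A, S.Finite → ∀ f : A → A, Set.InjOn f S →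
    (∀ i, ∀ a ∈ S, ∀ b ∈ S, (𝔸.rel i a b ↔ 𝔸.rel i (f a) (f b))) →
    ∃ g : A ≃ A, IsAuto 𝔸 g ∧ ∀ a ∈ S, g a = f a

/-- `(c,d)` lies in the orbit of `(a,b)` under `Aut(𝔸)`. -/
def SameOrbit (𝔸 : BinaryCore A κ) (a b c d : A) : Prop :=
  ∃ g : A ≃ A, IsAuto 𝔸 g ∧ g a = c ∧ g b = d

/-- An orbital: the orbit of a pair of elements under `Aut(𝔸)`. -/
def IsOrbital (𝔸 : BinaryCore A κ) (O : A → A → Prop) : Prop :=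
  ∃ a b : A, ∀ c d : A, O c d ↔ SameOrbit 𝔸 a b c d

/-- Anti-reflexive binary relation. -/
def AntiRefl (C : A → A → Prop) : Prop := ∀ a b, C a b → a ≠ b

/-- The converse `C⁻¹` of a binary relation. -/
def inv (C : A → A → Prop) : A → A → Prop := fun a b => C b a

/-- A finite structure over the signature of `κ` binary relation symbols. -/
structure FinStruct (κ : ℕ) : Type where
  n : ℕ
  rel : Fin κ → Fin n → Fin n → Prop

/-- Embedding between finite structures. -/
def FSEmbeds (Γ Δ : FinStruct κ) : Prop :=
  ∃ f : Fin Γ.n → Fin Δ.n, Function.Injective f ∧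
    ∀ i a b, Γ.rel i a b ↔ Δ.rel i (f a) (f b)

/-- Embedding of a finite structure into a binary core. -/
def EmbedsCore (Γ : FinStruct κ) (𝔸 : BinaryCore A κ) : Prop :=
  ∃ f : Fin Γ.n → A, Function.Injective f ∧
    ∀ i a b, Γ.rel i a b ↔ 𝔸.rel i (f a) (f b)

/-- `𝔸` is finitely bounded with set of bounds `𝔅`. -/
def FinBoundedBy (𝔸 : BinaryCore A κ) (𝔅 : Set (FinStruct κ)) : Prop :=
  𝔅.Finite ∧ ∀ Δ : FinStruct κ, (EmbedsCore Δ 𝔸 ↔ ∀ Γ ∈ 𝔅, ¬ FSEmbeds Γ Δ)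

/-- Liberal: the bounds contain no structures of size 3, 4, 5 or 6. -/
def Liberal (𝔅 : Set (FinStruct κ)) : Prop :=
  ∀ Γ ∈ 𝔅, Γ.n ≠ 3 ∧ Γ.n ≠ 4 ∧ Γ.n ≠ 5 ∧ Γ.n ≠ 6

/-- `MaxBound`: the maximum of 3 and the size of the largest bound. -/
noncomputable def maxBound (𝔅 : Set (FinStruct κ)) : ℕ :=
  max 3 (sSup (FinStruct.n '' 𝔅))

/-- `𝔹` is a first-order expansion of the binary core `𝔸`. -/
def IsFOExpansion (𝔹 : RelStruct A) (𝔸 : BinaryCore A κ) : Prop :=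
  (∀ i : Fin κ, ∃ j : 𝔹.ι, ∃ h : 𝔹.arity j = 2,
    ∀ u : Fin (𝔹.arity j) → A,
      𝔹.rel j u ↔ 𝔸.rel i (u (Fin.cast h.symm 0)) (u (Fin.cast h.symm 1))) ∧
  ∀ j : 𝔹.ι, FODef 𝔸.toRel (𝔹.arity j) (𝔹.rel j)

/-! CSP instances -/

/-- A constraint over `𝔹` with variables from `V`. -/
structure Constraint (𝔹 : RelStruct A) (V : Type) : Type where
  idx : 𝔹.ι
  scope : Fin (𝔹.arity idx) → V

/-- `t` restricted to `X` belongs to the projection of the constraint `c` to `X`. -/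
def Constraint.projOK {𝔹 : RelStruct A} {V : Type} (c : Constraint 𝔹 V)
    (X : Set V) (t : V → A) : Prop :=
  ∃ u : Fin (𝔹.arity c.idx) → A, 𝔹.rel c.idx u ∧
    ∀ p, c.scope p ∈ X → u p = t (c.scope p)

def IsSolution {𝔹 : RelStruct A} {V : Type} (I : Set (Constraint 𝔹 V)) (s : V → A) : Prop :=
  ∀ c ∈ I, 𝔹.rel c.idx fun p => s (c.scope p)

/-- Non-trivial: no constraint carries the empty relation. -/
def NonTrivial {𝔹 : RelStruct A} {V : Type} (I : Set (Constraint 𝔹 V)) : Prop :=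
  ∀ c ∈ I, ∃ u, 𝔹.rel c.idx u

/-- `(k,l)`-minimality. -/
def IsMinimal {𝔹 : RelStruct A} {V : Type} (I : Set (Constraint 𝔹 V)) (k l : ℕ) : Prop :=
  (∀ X : Set V, X.Finite → X.ncard ≤ l → ∃ c ∈ I, X ⊆ Set.range c.scope) ∧
  ∀ X : Set V, X.Finite → X.ncard ≤ k → ∀ c₁ ∈ I, ∀ c₂ ∈ I,
    X ⊆ Set.range c₁.scope → X ⊆ Set.range c₂.scope →
    ∀ t : V → A, (c₁.projOK X t ↔ c₂.projOK X t)

/-- `𝔹` has relational width `(k,l)`. -/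
def HasRelWidth (𝔹 : RelStruct A) (k l : ℕ) : Prop :=
  ∀ (V : Type), Finite V → ∀ I : Set (Constraint 𝔹 V), I.Finite →
    IsMinimal I k l → ((∃ s, IsSolution I s) ↔ NonTrivial I)

/-- `𝔹` has strict width `k`. -/
def HasStrictWidth (𝔹 : RelStruct A) (k : ℕ) : Prop :=
  ∃ l, k ≤ l ∧ ∀ (V : Type), Finite V → ∀ I : Set (Constraint 𝔹 V), I.Finite →
    IsMinimal I k l → ∀ (W : Set V) (t : V → A),
      (∀ c ∈ I, c.projOK W t) → ∃ s, IsSolution I s ∧ ∀ v ∈ W, s v = t v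

def BoundedStrictWidth (𝔹 : RelStruct A) : Prop := ∃ k, HasStrictWidth 𝔹 k

/-- The structure with domain `A` and a single `n`-ary relation `R`. -/
def singleRel (n : ℕ) (R : (Fin n → A) → Prop) : RelStruct A :=
  ⟨PUnit, fun _ => n, fun _ => R⟩

/-! Projections and entailment -/

/-- The projection of an `n`-ary relation to coordinates `(p,q)`. -/
def proj2 {n : ℕ} (R : (Fin n → A) → Prop) (p q : Fin n) : A → A → Prop :=
  fun a b => ∃ t, R t ∧ t p = a ∧ t q = b

/-- `R` entails no equalities. -/
def EntailsNoEq {n : ℕ} (R : (Fin n → A) → Prop) : Prop :=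
  ∀ i j : Fin n, i ≠ j → ∃ t, R t ∧ t i ≠ t j

/-- `R` efficiently entails `C₁(x_i,x_j) ⟹ D₁(x_k,x_l)`. -/
def EffEntails {n : ℕ} (R : (Fin n → A) → Prop) (i j k l : Fin n)
    (C₁ D₁ : A → A → Prop) : Prop :=
  (∀ t, R t → C₁ (t i) (t j) → D₁ (t k) (t l)) ∧
  (∀ a b, C₁ a b → proj2 R i j a b) ∧ C₁ ≠ proj2 R i j ∧
  (∀ a b, D₁ a b → proj2 R k l a b) ∧ D₁ ≠ proj2 R k l

/-- Critical ternary relation over `(𝔹, C₁, C₂, D₁, D₂)`. -/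
def IsCriticalTernary (𝔹 : RelStruct A) (R : (Fin 3 → A) → Prop)
    (C₁ C₂ D₁ D₂ : A → A → Prop) : Prop :=
  PPDef 𝔹 3 R ∧ PPDef2 𝔹 C₁ ∧ PPDef2 𝔹 C₂ ∧ PPDef2 𝔹 D₁ ∧ PPDef2 𝔹 D₂ ∧
  (∀ a b, ¬ (C₁ a b ∧ C₂ a b)) ∧
  (∀ a b, C₁ a b → proj2 R 0 1 a b) ∧ (∀ a b, C₂ a b → proj2 R 0 1 a b) ∧
  (∀ a b, ¬ (D₁ a b ∧ D₂ a b)) ∧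
  (∀ a b, D₁ a b → proj2 R 1 2 a b) ∧ (∀ a b, D₂ a b → proj2 R 1 2 a b) ∧
  AntiRefl C₁ ∧ AntiRefl D₁ ∧
  ((AntiRefl C₂ ∧ AntiRefl D₂) ∨
    ((∀ a b, C₂ a b ↔ a = b) ∧ (∀ a b, D₂ a b ↔ a = b))) ∧
  (∀ t, R t → C₁ (t 0) (t 1) → D₁ (t 1) (t 2)) ∧
  (∀ t, R t → D₁ (t 1) (t 2) → C₁ (t 0) (t 1)) ∧
  (∀ t, C₁ (t 0) (t 1) → D₁ (t 1) (t 2) → R t) ∧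
  (∀ t, C₂ (t 0) (t 1) → D₂ (t 1) (t 2) → R t)

/-! `OP`-tuples and the `⋈`-operations -/

/-- A ternary `OP`-tuple. -/
def OP3 (O P : A → A → Prop) (t : Fin 3 → A) : Prop := O (t 0) (t 1) ∧ P (t 1) (t 2)

/-- A quaternary `OP`-tuple. -/
def OP4 (O P : A → A → Prop) (t : Fin 4 → A) : Prop := O (t 0) (t 1) ∧ P (t 2) (t 3)

/-- Non-constant tuple. -/
def NonConstant {n : ℕ} (t : Fin n → A) : Prop := ∃ i j, t i ≠ t j

/-- `R₁ ⋈ R₂` for ternary relations. -/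
def bowtie3 (R₁ R₂ : (Fin 3 → A) → Prop) : (Fin 3 → A) → Prop :=
  fun t => ∃ y, R₁ ![t 0, t 1, y] ∧ R₂ ![y, t 1, t 2]

/-- `R₁ ⋈ R₂` for quaternary relations. -/
def bowtie4 (R₁ R₂ : (Fin 4 → A) → Prop) : (Fin 4 → A) → Prop :=
  fun t => ∃ y₁ y₂, R₁ ![t 0, t 1, y₁, y₂] ∧ R₂ ![y₂, y₁, t 2, t 3]

/-- `R₁ ⋈₃ R₂` for quaternary relations. -/
def bowtie43 (R₁ R₂ : (Fin 4 → A) → Prop) : (Fin 3 → A) → Prop :=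
  fun t => ∃ y₁ y₂, R₁ ![t 0, t 1, y₁, y₂] ∧ R₂ ![y₂, y₁, t 1, t 2]

/-! Implications -/

inductive Dir : Type where
  | fwd
  | bwd
  deriving DecidableEq

def lpos3 : Dir → Fin 3 × Fin 3 | .fwd => (0, 1) | .bwd => (1, 0)
def rpos3 : Dir → Fin 3 × Fin 3 | .fwd => (1, 2) | .bwd => (2, 1)
def lpos4 : Dir → Fin 4 × Fin 4 | .fwd => (0, 1) | .bwd => (1, 0)
def rpos4 : Dir → Fin 4 × Fin 4 | .fwd => (2, 3) | .bwd => (3, 2)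

/-- Ternary `(𝔹,C,D,C₁,D₁,L,P)`-implications. -/
def IsTerImpl (𝔹 : RelStruct A) (C D C₁ D₁ : A → A → Prop) (L P : Dir)
    (R : (Fin 3 → A) → Prop) : Prop :=
  EntailsNoEq R ∧ PPDef 𝔹 3 R ∧ PPDef2 𝔹 C₁ ∧ PPDef2 𝔹 D₁ ∧
  proj2 R (lpos3 L).1 (lpos3 L).2 = C ∧
  proj2 R (rpos3 P).1 (rpos3 P).2 = D ∧
  EffEntails R (lpos3 L).1 (lpos3 L).2 (rpos3 P).1 (rpos3 P).2 C₁ D₁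

/-- Quaternary `(𝔹,C,D,C₁,D₁,L,P)`-implications. -/
def IsQuatImpl (𝔹 : RelStruct A) (C D C₁ D₁ : A → A → Prop) (L P : Dir)
    (R : (Fin 4 → A) → Prop) : Prop :=
  EntailsNoEq R ∧ PPDef 𝔹 4 R ∧ PPDef2 𝔹 C₁ ∧ PPDef2 𝔹 D₁ ∧
  proj2 R (lpos4 L).1 (lpos4 L).2 = C ∧
  proj2 R (rpos4 P).1 (rpos4 P).2 = D ∧
  EffEntails R (lpos4 L).1 (lpos4 L).2 (rpos4 P).1 (rpos4 P).2 C₁ D₁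

/-- A ternary or quaternary relation. -/
inductive Rel34 (A : Type) : Type where
  | ter : ((Fin 3 → A) → Prop) → Rel34 A
  | quat : ((Fin 4 → A) → Prop) → Rel34 A

/-- `(𝔹,C,D,C₁,D₁,L,P)`-implications (ternary or quaternary). -/
def IsImpl (𝔹 : RelStruct A) (C D C₁ D₁ : A → A → Prop) (L P : Dir) : Rel34 A → Prop
  | .ter R => IsTerImpl 𝔹 C D C₁ D₁ L P R
  | .quat R => IsQuatImpl 𝔹 C D C₁ D₁ L P R

def Rel34.FODefIn (S : RelStruct A) : Rel34 A → Prop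
  | .ter R => FODef S 3 R
  | .quat R => FODef S 4 R

/-- `R` contains an `OP`-tuple. -/
def Rel34.hasOP (O P : A → A → Prop) : Rel34 A → Prop
  | .ter R => ∃ t, R t ∧ O (t 0) (t 1) ∧ P (t 1) (t 2)
  | .quat R => ∃ t, R t ∧ O (t 0) (t 1) ∧ P (t 2) (t 3)

/-- The composition `R₁ ∘ R₂`; the middle `Bool` argument records whether `P₁ = L₂`. -/
def Rel34.comp : Rel34 A → Bool → Rel34 A → Rel34 A
  | .quat R₁, true, .quat R₂ =>
      .quat fun t => ∃ y₁ y₂, R₁ ![t 0, t 1, y₁, y₂] ∧ R₂ ![y₁, y₂, t 2, t 3]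
  | .quat R₁, false, .quat R₂ =>
      .quat fun t => ∃ y₁ y₂, R₁ ![t 0, t 1, y₁, y₂] ∧ R₂ ![y₂, y₁, t 2, t 3]
  | .quat R₁, true, .ter R₂ =>
      .quat fun t => ∃ y, R₁ ![t 0, t 1, y, t 2] ∧ R₂ ![y, t 2, t 3]
  | .quat R₁, false, .ter R₂ =>
      .quat fun t => ∃ y, R₁ ![t 0, t 1, t 2, y] ∧ R₂ ![y, t 2, t 3]
  | .ter R₁, true, .quat R₂ =>
      .quat fun t => ∃ y, R₁ ![t 0, t 1, y] ∧ R₂ ![t 1, y, t 2, t 3]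
  | .ter R₁, false, .quat R₂ =>
      .quat fun t => ∃ y, R₁ ![t 0, t 1, y] ∧ R₂ ![y, t 1, t 2, t 3]
  | .ter R₁, true, .ter R₂ =>
      .quat fun t => R₁ ![t 0, t 1, t 2] ∧ R₂ ![t 1, t 2, t 3]
  | .ter R₁, false, .ter R₂ =>
      .ter fun t => ∃ y, R₁ ![t 0, t 1, y] ∧ R₂ ![y, t 1, t 2]

/-! The bipartite digraph of a pair of implications -/

/-- Vertices: left copies `O_L` and right copies `O_R` of binary relations. -/
abbrev BVert (A : Type) : Type := (A → A → Prop) ⊕ (A → A → Prop)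

/-- `V_L(D)`. -/
def VL (𝔸 : BinaryCore A κ) (D : A → A → Prop) : Set (BVert A) :=
  {v | ∃ O : A → A → Prop, v = Sum.inl O ∧ IsOrbital 𝔸 O ∧ ∀ a b, O a b → D a b}

/-- `V_R(D)`. -/
def VR (𝔸 : BinaryCore A κ) (D : A → A → Prop) : Set (BVert A) :=
  {v | ∃ O : A → A → Prop, v = Sum.inr O ∧ IsOrbital 𝔸 O ∧ ∀ a b, O a b → D a b}

/-- The vertex set of `B_{R₁,R₂}`: `V_L(C) ∪ V_R(C)`. -/
def VertSet (𝔸 : BinaryCore A κ) (C : A → A → Prop) : Set (BVert A) :=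
  VL 𝔸 C ∪ VR 𝔸 C

/-- The arcs of the bipartite digraph `B_{R₁,R₂}`. -/
def BArc (R₁ R₂ : Rel34 A) : BVert A → BVert A → Prop
  | Sum.inl O, Sum.inr P => R₁.hasOP O (inv P)
  | Sum.inr P, Sum.inl O => R₂.hasOP P (inv O)
  | _, _ => False

/-- The arcs of `B_{R₁,R₂}` restricted to the vertex set `V_L(C) ∪ V_R(C)`. -/
def BArc' (𝔸 : BinaryCore A κ) (C : A → A → Prop) (R₁ R₂ : Rel34 A)
    (v w : BVert A) : Prop :=
  v ∈ VertSet 𝔸 C ∧ w ∈ VertSet 𝔸 C ∧ BArc R₁ R₂ v w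

/-- A strongly connected component of the digraph `(Vs, Arc)`. -/
def IsSCC {α : Type} (Arc : α → α → Prop) (Vs : Set α) (S : Set α) : Prop :=
  S ⊆ Vs ∧ (∀ u ∈ S, ∀ v ∈ S, Relation.ReflTransGen Arc u v) ∧
  ∀ T : Set α, S ⊆ T → T ⊆ Vs →
    (∀ u ∈ T, ∀ v ∈ T, Relation.ReflTransGen Arc u v) → T = S

/-- A set of strongly connected components. -/
def IsSCCSet {α : Type} (Arc : α → α → Prop) (Vs : Set α) (S : Set α) : Prop :=
  ∀ v ∈ S, ∃ T, IsSCC Arc Vs T ∧ v ∈ T ∧ T ⊆ S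

/-- A sink: every arc originating in `S` finishes in `S`. -/
def IsSink {α : Type} (Arc : α → α → Prop) (S : Set α) : Prop :=
  ∀ u ∈ S, ∀ v, Arc u v → v ∈ S

/-- A source: every arc finishing in `S` originates in `S`. -/
def IsSource {α : Type} (Arc : α → α → Prop) (S : Set α) : Prop :=
  ∀ v ∈ S, ∀ u, Arc u v → u ∈ S

/-- A complete `(𝔹,C,C₁,→,←)`-implication. -/
def IsCompleteImpl (𝔸 : BinaryCore A κ) (𝔹 : RelStruct A)
    (C C₁ : A → A → Prop) (R : Rel34 A) : Prop :=
  IsImpl 𝔹 C C C₁ C₁ .fwd .bwd R ∧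
  ∀ S : Set (BVert A), IsSCC (BArc' 𝔸 C R R) (VertSet 𝔸 C) S →
    (∃ D₁ : A → A → Prop, (∀ a b, D₁ a b → C a b) ∧ S = VL 𝔸 D₁ ∪ VR 𝔸 D₁) ∧
    ∀ O P : A → A → Prop, Sum.inl O ∈ S → Sum.inr P ∈ S →
      BArc' 𝔸 C R R (Sum.inl O) (Sum.inr P) ∧ BArc' 𝔸 C R R (Sum.inr P) (Sum.inl O)

/-! The graph of a CSP instance -/

/-- The projection of a constraint to a tuple of variables. -/
def Constraint.projT {𝔹 : RelStruct A} {V : Type} (c : Constraint 𝔹 V)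
    {n : ℕ} (xs : Fin n → V) : (Fin n → A) → Prop :=
  fun t => ∃ u, 𝔹.rel c.idx u ∧ ∀ p q, c.scope p = xs q → u p = t q

/-- `x` occurs in the scope of `c`. -/
def InScope {𝔹 : RelStruct A} {V : Type} (c : Constraint 𝔹 V) (x : V) : Prop :=
  ∃ p, c.scope p = x

/-- `𝓘_{x,y}`: the projection to `(x,y)` of (any) constraint whose scope contains `x,y`. -/
def IProj {𝔹 : RelStruct A} {V : Type} (I : Set (Constraint 𝔹 V)) (x y : V) :
    A → A → Prop :=
  fun a b => ∃ c ∈ I, InScope c x ∧ InScope c y ∧ c.projT ![x, y] ![a, b]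

/-- Vertices `((v₁,v₂),C)` of the graph `G_𝓘`. -/
abbrev GVertT (A V : Type) : Type := (V × V) × (A → A → Prop)

/-- A legitimate vertex of `G_𝓘`: `C` is non-empty, pp-definable in `𝔹` and
`C ⊊ 𝓘_{v₁,v₂}`. -/
def GVert {𝔹 : RelStruct A} {V : Type} (I : Set (Constraint 𝔹 V))
    (v : GVertT A V) : Prop :=
  (∃ a b, v.2 a b) ∧ (∀ a b, v.2 a b → IProj I v.1.1 v.1.2 a b) ∧
  v.2 ≠ IProj I v.1.1 v.1.2 ∧ PPDef2 𝔹 v.2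

/-- The arcs of the graph `G_𝓘`. -/
def GArc {𝔹 : RelStruct A} {V : Type} (I : Set (Constraint 𝔹 V))
    (v w : GVertT A V) : Prop :=
  (w.1.1 = v.1.2 ∧ v.1.1 ≠ v.1.2 ∧ v.1.1 ≠ w.1.2 ∧ v.1.2 ≠ w.1.2 ∧
    ∃ c ∈ I, InScope c v.1.1 ∧ InScope c v.1.2 ∧ InScope c w.1.2 ∧
      ∃ L P : Dir,
        IsTerImpl 𝔹 (IProj I v.1.1 v.1.2) (IProj I v.1.2 w.1.2) v.2 w.2 L P
          (c.projT ![v.1.1, v.1.2, w.1.2])) ∨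
  (v.1.1 ≠ v.1.2 ∧ v.1.1 ≠ w.1.1 ∧ v.1.1 ≠ w.1.2 ∧ v.1.2 ≠ w.1.1 ∧
   v.1.2 ≠ w.1.2 ∧ w.1.1 ≠ w.1.2 ∧
    ∃ c ∈ I, InScope c v.1.1 ∧ InScope c v.1.2 ∧ InScope c w.1.1 ∧ InScope c w.1.2 ∧
      ∃ L P : Dir,
        IsQuatImpl 𝔹 (IProj I v.1.1 v.1.2) (IProj I w.1.1 w.1.2) v.2 w.2 L P
          (c.projT ![v.1.1, v.1.2, w.1.1, w.1.2]))

/-- Arcs of `G_𝓘` between legitimate vertices. -/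
def GArcV {𝔹 : RelStruct A} {V : Type} (I : Set (Constraint 𝔹 V))
    (v w : GVertT A V) : Prop :=
  GVert I v ∧ GVert I w ∧ GArc I v w

/-- The instance entails no equalities. -/
def InstNoEq {𝔹 : RelStruct A} {V : Type} (I : Set (Constraint 𝔹 V)) : Prop :=
  ∀ c ∈ I, ∀ p q : Fin (𝔹.arity c.idx), p ≠ q → ∃ u, 𝔹.rel c.idx u ∧ u p ≠ u q

/-- `𝔹` is implicationally simple: `G_𝓘` is acyclic for every `(2,MaxBound)`-minimal
instance `𝓘` of `CSP(𝔹)` that entails no equalities. -/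
def ImpSimple (𝔹 : RelStruct A) (𝔅 : Set (FinStruct κ)) : Prop :=
  ∀ (V : Type), Finite V → ∀ I : Set (Constraint 𝔹 V), I.Finite →
    IsMinimal I 2 (maxBound 𝔅) → InstNoEq I →
    ∀ v : GVertT A V, ¬ Relation.TransGen (GArcV I) v v

theorem fo_inv (𝔸 : BinaryCore A κ) (g : A ≃ A) (hg : IsAuto 𝔸 g) (φ : FO 𝔸.toRel) :
    ∀ f : ℕ → A, φ.sat (fun n => g (f n)) ↔ φ.sat f := by
  induction φ with
  | atom i v => intro f; exact hg i _ _
  | eq x y => intro f; exact g.injective.eq_iff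
  | neg φ ih => intro f; exact not_congr (ih f)
  | conj φ ψ ih₁ ih₂ => intro f; exact and_congr (ih₁ f) (ih₂ f)
  | ex x φ ih =>
    intro f
    have key : ∀ a, Function.update (fun n => g (f n)) x (g a)
        = fun n => g (Function.update f x a n) := by
      intro a; funext n
      by_cases h : n = x
      · subst h; simp
      · simp [h]
    constructor
    · rintro ⟨a, ha⟩
      refine ⟨g.symm a, (ih _).1 ?_⟩
      rw [← key]; simpa using ha
    · rintro ⟨a, ha⟩
      refine ⟨g a, ?_⟩
      rw [key]; exact (ih _).2 ha

theorem fodef_inv (𝔸 : BinaryCore A κ) (g : A ≃ A) (hg : IsAuto 𝔸 g) {n : ℕ}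
    {R : (Fin n → A) → Prop} (hR : FODef 𝔸.toRel n R) (t : Fin n → A) (a₀ : A) (ht : R t) :
    R (fun i => g (t i)) := by
  obtain ⟨φ, hφ⟩ := hR
  have h := hφ (fun k => if h : k < n then t ⟨k, h⟩ else a₀)
  have h2 := hφ (fun k => g (if h : k < n then t ⟨k, h⟩ else a₀))
  simp only [Fin.is_lt, dite_true, Fin.eta] at h h2
  exact h2.1 ((fo_inv 𝔸 g hg φ _).2 (h.2 ht))

theorem eq_transfer (𝔸 : BinaryCore A κ) {a b c d : A}
    (h : ∀ i, 𝔸.rel i a b ↔ 𝔸.rel i c d) (hc : c = d) : a = b := by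
  by_contra hab
  obtain ⟨i, hi⟩ := 𝔸.total a b hab
  exact 𝔸.antirefl i c d ((h i).1 hi) hc

theorem move (𝔸 : BinaryCore A κ) (hHom : IsHomogeneous 𝔸) {m : ℕ} (u v : Fin m → A)
    (h : ∀ i p q, 𝔸.rel i (u p) (u q) ↔ 𝔸.rel i (v p) (v q)) :
    ∃ g : A ≃ A, IsAuto 𝔸 g ∧ ∀ p, g (u p) = v p := by
  classical
  have huv : ∀ p q, u p = u q → v p = v q := fun p q hpq =>
    eq_transfer 𝔸 (fun i => (h i p q).symm) hpq
  have hvu : ∀ p q, v p = v q → u p = u q := fun p q hpq =>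
    eq_transfer 𝔸 (fun i => h i p q) hpq
  let f : A → A := fun a => if h : ∃ p, u p = a then v h.choose else a
  have hf : ∀ p, f (u p) = v p := by
    intro p
    have hp : ∃ q, u q = u p := ⟨p, rfl⟩
    simp only [f, dif_pos hp]
    exact huv _ _ hp.choose_spec
  obtain ⟨g, hg, hgf⟩ := hHom (Set.range u) (Set.finite_range u) f
    (by rintro _ ⟨p, rfl⟩ _ ⟨q, rfl⟩ hpq
        rw [hf, hf] at hpq; exact hvu _ _ hpq)
    (by rintro i _ ⟨p, rfl⟩ _ ⟨q, rfl⟩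
        rw [hf, hf]; exact h i p q)
  exact ⟨g, hg, fun p => (hgf _ ⟨p, rfl⟩).trans (hf p)⟩

theorem transfer (𝔸 : BinaryCore A κ) (hHom : IsHomogeneous 𝔸) {m : ℕ}
    {R : (Fin m → A) → Prop} (hR : FODef 𝔸.toRel m R) (a₀ : A) (u v : Fin m → A)
    (h : ∀ i p q, 𝔸.rel i (u p) (u q) ↔ 𝔸.rel i (v p) (v q)) (hu : R u) : R v := by
  obtain ⟨g, hg, hgu⟩ := move 𝔸 hHom u v h
  have := fodef_inv 𝔸 g hg hR u a₀ hu
  simpa only [hgu] using this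

theorem rel_self (𝔸 : BinaryCore A κ) (i : Fin κ) (a : A) : ¬ 𝔸.rel i a a :=
  fun h => 𝔸.antirefl i a a h rfl

theorem embed (𝔸 : BinaryCore A κ) (𝔅 : Set (FinStruct κ)) (hFB : FinBoundedBy 𝔸 𝔅)
    (hLib : Liberal 𝔅) (a₀ : A) {n : ℕ} (hn : n ≤ 6) (w : Fin n → Fin n → A)
    (hw : ∀ p q, p ≠ q → w p q ≠ w q p) :
    ∃ f : Fin n → A, ∀ i p q, 𝔸.rel i (f p) (f q) ↔ 𝔸.rel i (w p q) (w q p) := by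
  have key : EmbedsCore ⟨n, fun i p q => 𝔸.rel i (w p q) (w q p)⟩ 𝔸 := by
    refine (hFB.2 _).2 ?_
    rintro Γ hΓ ⟨h, hinj, hrel⟩
    have hcard : Γ.n ≤ n := by simpa using Fintype.card_le_of_injective h hinj
    have hL := hLib Γ hΓ
    have hΓA : ¬ EmbedsCore Γ 𝔸 := fun hE =>
      (hFB.2 Γ).1 hE Γ hΓ ⟨id, Function.injective_id, fun _ _ _ => Iff.rfl⟩
    have h2 : Γ.n ≤ 2 := by omega
    apply hΓA
    obtain ⟨m, r⟩ := Γ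
    dsimp only at *
    have hself : ∀ i p, ¬ r i p p := fun i p hp => rel_self 𝔸 i _ ((hrel i p p).1 hp)
    interval_cases m
    · exact ⟨fun _ => a₀, fun p => p.elim0, fun _ p => p.elim0⟩
    · refine ⟨fun _ => a₀, fun p q _ => Subsingleton.elim _ _, fun i p q => ?_⟩
      rw [Subsingleton.elim q p]
      simp only [hself, rel_self]
    · have h01 : (0 : Fin 2) ≠ 1 := by decide
      have hne := hw (h (0 : Fin 2)) (h (1 : Fin 2)) (fun e => h01 (hinj e))
      refine ⟨![w (h 0) (h 1), w (h 1) (h 0)], ?_, ?_⟩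
      · intro p q hpq
        fin_cases p <;> fin_cases q <;> simp at hpq ⊢
        · exact hne hpq
        · exact hne hpq.symm
      · intro i p q
        fin_cases p <;> fin_cases q
        · simp [hself, rel_self]
        · exact hrel i 0 1
        · exact hrel i 1 0
        · simp [hself, rel_self]
  obtain ⟨f, -, hf⟩ := key
  exact ⟨f, fun i p q => (hf i p q).symm⟩

theorem orb_rel (𝔸 : BinaryCore A κ) {O : A → A → Prop} (hO : IsOrbital 𝔸 O) {a b c d : A}
    (h₁ : O a b) (h₂ : O c d) (i : Fin κ) :
    (𝔸.rel i a b ↔ 𝔸.rel i c d) ∧ (𝔸.rel i b a ↔ 𝔸.rel i d c) := by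
  obtain ⟨x, y, hxy⟩ := hO
  obtain ⟨g, hg, rfl, rfl⟩ := (hxy _ _).1 h₁
  obtain ⟨g', hg', rfl, rfl⟩ := (hxy _ _).1 h₂
  exact ⟨(hg i _ _).trans (hg' i _ _).symm, (hg i _ _).trans (hg' i _ _).symm⟩

theorem orb_move (𝔸 : BinaryCore A κ) {O : A → A → Prop} (hO : IsOrbital 𝔸 O) {a b c d : A}
    (h₁ : O a b) (h₂ : O c d) : ∃ g : A ≃ A, IsAuto 𝔸 g ∧ g a = c ∧ g b = d := by
  obtain ⟨x, y, hxy⟩ := hO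
  obtain ⟨g, hg, rfl, rfl⟩ := (hxy _ _).1 h₁
  obtain ⟨g', hg', rfl, rfl⟩ := (hxy _ _).1 h₂
  refine ⟨g.symm.trans g', fun i a b => ?_, by simp, by simp⟩
  have := hg i (g.symm a) (g.symm b)
  simp only [Equiv.apply_symm_apply] at this
  exact (hg' i _ _).trans this.symm

theorem orb_auto (𝔸 : BinaryCore A κ) {O : A → A → Prop} (hO : IsOrbital 𝔸 O) {a b : A}
    (h₁ : O a b) (g : A ≃ A) (hg : IsAuto 𝔸 g) : O (g a) (g b) := by
  obtain ⟨x, y, hxy⟩ := hO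
  obtain ⟨g', hg', rfl, rfl⟩ := (hxy _ _).1 h₁
  exact (hxy _ _).2 ⟨g'.trans g, fun i a b => (hg i _ _).trans (hg' i _ _), rfl, rfl⟩

/-- Embed an `n`-point amalgam so that its first `m` points are a prescribed tuple. -/
theorem embed_over (𝔸 : BinaryCore A κ) (𝔅 : Set (FinStruct κ)) (hHom : IsHomogeneous 𝔸)
    (hFB : FinBoundedBy 𝔸 𝔅)
    (hLib : Liberal 𝔅) (a₀ : A) {n m : ℕ} (hn : n ≤ 6) (hm : m ≤ n) (w : Fin n → Fin n → A)
    (hw : ∀ p q, p ≠ q → w p q ≠ w q p) (t : Fin m → A)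
    (ht : ∀ p q : Fin m, w (Fin.castLE hm p) (Fin.castLE hm q) = t p) :
    ∃ f : Fin n → A, (∀ p, f (Fin.castLE hm p) = t p) ∧
      ∀ i p q, 𝔸.rel i (f p) (f q) ↔ 𝔸.rel i (w p q) (w q p) := by
  obtain ⟨f, hf⟩ := embed 𝔸 𝔅 hFB hLib a₀ hn w hw
  obtain ⟨g, hg, hgf⟩ := move 𝔸 hHom (fun p => f (Fin.castLE hm p)) t (by
    intro i p q
    rw [hf, ht, ht])
  exact ⟨fun p => g (f p), hgf, fun i p q => (hg i _ _).trans (hf i p q)⟩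

/-- **Observation 8.** For `R₁, R₂` both ternary or both quaternary relations
fo-definable in a liberal finitely bounded homogeneous binary core `𝔸`,
with `R₃ := R₁ ⋈ R₂` and orbitals `O₁, O₂, O₃`:
(i) if `R₁` has an `O₁O₂`-tuple `t₁` and `R₂` has an `O₂⁻¹O₃`-tuple `t₂`, then `R₃`
has an `O₁O₃`-tuple; (ii) if moreover `t₁, t₂` are injective then `R₃` contains all
injective `O₁O₃`-tuples; (iii) if `O₁,O₂,O₃` are `=` and `t₁,t₂` are non-constant,
then `R₃` contains all non-constant `==`-tuples. -/
theorem statement5 {A : Type} [Countable A] [Infinite A] {κ : ℕ}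
    (𝔸 : BinaryCore A κ) (𝔅 : Set (FinStruct κ))
    (hHom : IsHomogeneous 𝔸) (hFB : FinBoundedBy 𝔸 𝔅) (hLib : Liberal 𝔅)
    (O₁ O₂ O₃ : A → A → Prop)
    (hO₁ : IsOrbital 𝔸 O₁) (hO₂ : IsOrbital 𝔸 O₂) (hO₃ : IsOrbital 𝔸 O₃) :
    (∀ R₁ R₂ : (Fin 3 → A) → Prop, FODef 𝔸.toRel 3 R₁ → FODef 𝔸.toRel 3 R₂ →
      ∀ t₁ t₂ : Fin 3 → A, R₁ t₁ → OP3 O₁ O₂ t₁ → R₂ t₂ → OP3 (inv O₂) O₃ t₂ →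
        (∃ t, bowtie3 R₁ R₂ t ∧ OP3 O₁ O₃ t) ∧
        (Function.Injective t₁ → Function.Injective t₂ →
          ∀ t, Function.Injective t → OP3 O₁ O₃ t → bowtie3 R₁ R₂ t) ∧
        (O₁ = eqRel A → O₂ = eqRel A → O₃ = eqRel A →
          NonConstant t₁ → NonConstant t₂ →
          ∀ t, NonConstant t → OP3 (eqRel A) (eqRel A) t → bowtie3 R₁ R₂ t)) ∧
    (∀ R₁ R₂ : (Fin 4 → A) → Prop, FODef 𝔸.toRel 4 R₁ → FODef 𝔸.toRel 4 R₂ →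
      ∀ t₁ t₂ : Fin 4 → A, R₁ t₁ → OP4 O₁ O₂ t₁ → R₂ t₂ → OP4 (inv O₂) O₃ t₂ →
        (∃ t, bowtie4 R₁ R₂ t ∧ OP4 O₁ O₃ t) ∧
        (Function.Injective t₁ → Function.Injective t₂ →
          ∀ t, Function.Injective t → OP4 O₁ O₃ t → bowtie4 R₁ R₂ t) ∧
        (O₁ = eqRel A → O₂ = eqRel A → O₃ = eqRel A →
          NonConstant t₁ → NonConstant t₂ →
          ∀ t, NonConstant t → OP4 (eqRel A) (eqRel A) t → bowtie4 R₁ R₂ t)) := by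
  have a₀ : A := Classical.arbitrary A
  refine ⟨?_, ?_⟩
  · intro R₁ R₂ hR₁ hR₂ t₁ t₂ h₁ ⟨hA, hB⟩ h₂ ⟨hC, hD⟩
    refine ⟨?_, ?_, ?_⟩
    · obtain ⟨g, hg, hg1, hg2⟩ := orb_move 𝔸 hO₂ hC hB
      have h₂' := fodef_inv 𝔸 g hg hR₂ t₂ a₀ h₂
      have hD' := orb_auto 𝔸 hO₃ hD g hg
      refine ⟨![t₁ 0, t₁ 1, g (t₂ 2)], ⟨t₁ 2, ?_, ?_⟩, hA, ?_⟩
      · convert h₁ using 1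
        funext p; fin_cases p <;> rfl
      · convert h₂' using 1
        funext p; fin_cases p <;> simp [hg1, hg2]
      · simpa [hg1] using hD'
    · intro i₁ i₂ t it ⟨hE, hF⟩
      obtain ⟨f, hft, hf⟩ := embed_over 𝔸 𝔅 hHom hFB hLib a₀ (n := 4) (m := 3) (by norm_num)
        (by norm_num)
        ![![t 0, t 0, t 0, t₁ 0], ![t 1, t 1, t 1, t₁ 1], ![t 2, t 2, t 2, t₂ 2],
          ![t₁ 2, t₁ 2, t₂ 0, t₁ 2]]
        (by intro p q hpq
            fin_cases p <;> fin_cases q <;>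
              simp [it.eq_iff, i₁.eq_iff, i₂.eq_iff] at hpq ⊢)
        t (by intro p q; fin_cases p <;> fin_cases q <;> rfl)
      have e0 : f 0 = t 0 := hft 0
      have e1 : f 1 = t 1 := hft 1
      have e2 : f 2 = t 2 := hft 2
      have o1 := orb_rel 𝔸 hO₁ hA hE
      have o2 := orb_rel 𝔸 hO₂ hB hC
      have o3 := orb_rel 𝔸 hO₃ hD hF
      rw [← e0, ← e1] at o1
      rw [← e1, ← e2] at o3
      refine ⟨f 3, transfer 𝔸 hHom hR₁ a₀ t₁ _ ?_ h₁, transfer 𝔸 hHom hR₂ a₀ t₂ _ ?_ h₂⟩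
      · rw [← e0, ← e1]
        intro i p q
        fin_cases p <;> fin_cases q
        · simp [rel_self]
        · exact (o1 i).1
        · exact (hf i 0 3).symm
        · exact (o1 i).2
        · simp [rel_self]
        · exact (hf i 1 3).symm
        · exact (hf i 3 0).symm
        · exact (hf i 3 1).symm
        · simp [rel_self]
      · rw [← e2, ← e1]
        intro i p q
        fin_cases p <;> fin_cases q
        · simp [rel_self]
        · exact (o2 i).2.symm.trans (hf i 3 1).symm
        · exact (hf i 3 2).symm
        · exact (o2 i).1.symm.trans (hf i 1 3).symm
        · simp [rel_self]
        · exact (o3 i).1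
        · exact (hf i 2 3).symm
        · exact (o3 i).2
        · simp [rel_self]
    · intro hO1 hO2 _ ⟨p, q, hpq⟩
      rw [hO1] at hA
      rw [hO2] at hB
      have hA : t₁ 0 = t₁ 1 := hA
      have hB : t₁ 1 = t₁ 2 := hB
      exact absurd (by fin_cases p <;> fin_cases q <;> simp [hA, hB]) hpq
  · intro R₁ R₂ hR₁ hR₂ t₁ t₂ h₁ ⟨hA, hB⟩ h₂ ⟨hC, hD⟩
    refine ⟨?_, ?_, ?_⟩
    · obtain ⟨g, hg, hg1, hg2⟩ := orb_move 𝔸 hO₂ hC hB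
      have h₂' := fodef_inv 𝔸 g hg hR₂ t₂ a₀ h₂
      have hD' := orb_auto 𝔸 hO₃ hD g hg
      refine ⟨![t₁ 0, t₁ 1, g (t₂ 2), g (t₂ 3)], ⟨t₁ 2, t₁ 3, ?_, ?_⟩, hA, hD'⟩
      · convert h₁ using 1
        funext p; fin_cases p <;> rfl
      · convert h₂' using 1
        funext p; fin_cases p <;> simp [hg1, hg2]
    · intro i₁ i₂ t it ⟨hE, hF⟩
      obtain ⟨f, hft, hf⟩ := embed_over 𝔸 𝔅 hHom hFB hLib a₀ (n := 6) (m := 4) (by norm_num)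
        (by norm_num)
        ![![t 0, t 0, t 0, t 0, t₁ 0, t₁ 0], ![t 1, t 1, t 1, t 1, t₁ 1, t₁ 1],
          ![t 2, t 2, t 2, t 2, t₂ 2, t₂ 2], ![t 3, t 3, t 3, t 3, t₂ 3, t₂ 3],
          ![t₁ 2, t₁ 2, t₂ 1, t₂ 1, t₁ 2, t₁ 2], ![t₁ 3, t₁ 3, t₂ 0, t₂ 0, t₁ 3, t₁ 3]]
        (by intro p q hpq
            fin_cases p <;> fin_cases q <;>
              simp [it.eq_iff, i₁.eq_iff, i₂.eq_iff] at hpq ⊢)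
        t (by intro p q; fin_cases p <;> fin_cases q <;> rfl)
      have e0 : f 0 = t 0 := hft 0
      have e1 : f 1 = t 1 := hft 1
      have e2 : f 2 = t 2 := hft 2
      have e3 : f 3 = t 3 := hft 3
      have o1 := orb_rel 𝔸 hO₁ hA hE
      have o2 := orb_rel 𝔸 hO₂ hB hC
      have o3 := orb_rel 𝔸 hO₃ hD hF
      rw [← e0, ← e1] at o1
      rw [← e2, ← e3] at o3
      refine ⟨f 4, f 5, transfer 𝔸 hHom hR₁ a₀ t₁ _ ?_ h₁, transfer 𝔸 hHom hR₂ a₀ t₂ _ ?_ h₂⟩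
      · rw [← e0, ← e1]
        intro i p q
        fin_cases p <;> fin_cases q
        · simp [rel_self]
        · exact (o1 i).1
        · exact (hf i 0 4).symm
        · exact (hf i 0 5).symm
        · exact (o1 i).2
        · simp [rel_self]
        · exact (hf i 1 4).symm
        · exact (hf i 1 5).symm
        · exact (hf i 4 0).symm
        · exact (hf i 4 1).symm
        · simp [rel_self]
        · exact (hf i 4 5).symm
        · exact (hf i 5 0).symm
        · exact (hf i 5 1).symm
        · exact (hf i 5 4).symm
        · simp [rel_self]
      · rw [← e2, ← e3]
        intro i p q
        fin_cases p <;> fin_cases q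
        · simp [rel_self]
        · exact (o2 i).2.symm.trans (hf i 5 4).symm
        · exact (hf i 5 2).symm
        · exact (hf i 5 3).symm
        · exact (o2 i).1.symm.trans (hf i 4 5).symm
        · simp [rel_self]
        · exact (hf i 4 2).symm
        · exact (hf i 4 3).symm
        · exact (hf i 2 5).symm
        · exact (hf i 2 4).symm
        · simp [rel_self]
        · exact (o3 i).1
        · exact (hf i 3 5).symm
        · exact (hf i 3 4).symm
        · exact (o3 i).2
        · simp [rel_self]
    · intro hO1 hO2 hO3 n₁ n₂ t nt ⟨hE, hF⟩
      rw [hO1] at hA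
      rw [hO2] at hB hC
      rw [hO3] at hD
      have hA : t₁ 0 = t₁ 1 := hA
      have hB : t₁ 2 = t₁ 3 := hB
      have hC : t₂ 1 = t₂ 0 := hC
      have hD : t₂ 2 = t₂ 3 := hD
      have hE : t 0 = t 1 := hE
      have hF : t 2 = t 3 := hF
      have nc : ∀ s : Fin 4 → A, s 0 = s 1 → s 2 = s 3 → NonConstant s → s 0 ≠ s 2 := by
        rintro s h01 h23 ⟨p, q, hpq⟩ h02
        exact absurd (by fin_cases p <;> fin_cases q <;> simp [← h01, ← h23, h02]) hpq
      have m₁ := nc t₁ hA hB n₁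
      have m₂ := nc t₂ hC.symm hD n₂
      have m := nc t hE hF nt
      obtain ⟨f, hft, hf⟩ := embed_over 𝔸 𝔅 hHom hFB hLib a₀ (n := 3) (m := 2) (by norm_num)
        (by norm_num)
        ![![t 0, t 0, t₁ 0], ![t 2, t 2, t₂ 2], ![t₁ 2, t₂ 0, t₁ 2]]
        (by intro p q hpq
            fin_cases p <;> fin_cases q <;>
              simp [m, m₁, m₂, m.symm, m₁.symm, m₂.symm] at hpq ⊢)
        ![t 0, t 2] (by intro p q; fin_cases p <;> fin_cases q <;> rfl)
      have e0 : f 0 = t 0 := hft 0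
      have e1 : f 1 = t 2 := hft 1
      have f02 : ∀ i, 𝔸.rel i (t 0) (f 2) ↔ 𝔸.rel i (t₁ 0) (t₁ 2) := fun i => e0 ▸ hf i 0 2
      have f20 : ∀ i, 𝔸.rel i (f 2) (t 0) ↔ 𝔸.rel i (t₁ 2) (t₁ 0) := fun i => e0 ▸ hf i 2 0
      have f12 : ∀ i, 𝔸.rel i (t 2) (f 2) ↔ 𝔸.rel i (t₂ 2) (t₂ 0) := fun i => e1 ▸ hf i 1 2
      have f21 : ∀ i, 𝔸.rel i (f 2) (t 2) ↔ 𝔸.rel i (t₂ 0) (t₂ 2) := fun i => e1 ▸ hf i 2 1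
      refine ⟨f 2, f 2, transfer 𝔸 hHom hR₁ a₀ t₁ _ ?_ h₁, transfer 𝔸 hHom hR₂ a₀ t₂ _ ?_ h₂⟩
      · intro i p q
        fin_cases p <;> fin_cases q <;> simp [← hA, ← hB, ← hE, f02, f20, rel_self]
      · intro i p q
        fin_cases p <;> fin_cases q <;> simp [hC, ← hD, ← hF, f12, f21, rel_self]

end Wrona
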